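/- Suppose Assumption (A0) holds and each U_i is L_i-Lipschitz (Assumption (A1)). Then for every ρ > 0, ‖π_ρ − π‖_TV ≤ 1 − ∏_{i=1}^b Δ_{d_i}^{(i)}(ρ), where Δ_{d_i}^{(i)}(ρ) = D_{−d_i}(L_iρ)/D_{−d_i}(−L_iρ) and D_{−d}(z) = exp(−z²/4)·Γ(d)^{−1}·∫_0^∞ exp(−xz − x²/2)x^{d−1}dx is the parabolic cylinder function. Moreover, as ρ → 0, ‖π_ρ − π‖_TV ≤ 2ρ·Σ_{i=1}^b d_i^{1/2}L_i + o(ρ). -/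

import Mathlib

/-!
STATEMENT 9: Under (A0) and (A1) (each Uᵢ is Lᵢ-Lipschitz), for every ρ > 0,
‖π_ρ − π‖_TV ≤ 1 − ∏ᵢ D_{−dᵢ}(Lᵢρ)/D_{−dᵢ}(−Lᵢρ), where D is the parabolic
cylinder function; moreover ‖π_ρ − π‖_TV ≤ 2ρΣᵢ√dᵢ Lᵢ + o(ρ) as ρ → 0⁺.
-/

open MeasureTheory Matrix Asymptotics
open scoped ENNReal BigOperators Topology

noncomputable section

abbrev EV (n : ℕ) := EuclideanSpace ℝ (Fin n)

/-- Action of a matrix on a Euclidean vector. -/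
def mvec {m n : ℕ} (A : Matrix (Fin m) (Fin n) ℝ) (x : EV n) : EV m :=
  (EuclideanSpace.equiv (Fin m) ℝ).symm (A.mulVec (EuclideanSpace.equiv (Fin n) ℝ x))

/-- The parabolic cylinder special function `D_{−dneg}(z)` (for `dneg > 0`). -/
def parCyl (dneg : ℝ) (z : ℝ) : ℝ :=
  Real.exp (-z ^ 2 / 4) * (Real.Gamma dneg)⁻¹ *
    ∫ x in Set.Ioi (0 : ℝ), Real.exp (-x * z - x ^ 2 / 2) * x ^ (dneg - 1)

/-- TV distance (1/2)∫|p − q| between the normalized versions of the target density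
π ∝ exp(−ΣᵢUᵢ(Aᵢθ)) and the marginal π_ρ of the split model. -/
def tvBias {d b : ℕ} (dd : Fin b → ℕ) (A : ∀ i, Matrix (Fin (dd i)) (Fin d) ℝ)
    (U : ∀ i, EV (dd i) → ℝ) (ρ : ℝ) : ℝ :=
  (1 / 2) * ∫ θ : EV d,
    |Real.exp (-(∑ i, U i (mvec (A i) θ))) /
        (∫ θ' : EV d, Real.exp (-(∑ i, U i (mvec (A i) θ')))) -
      (∫ z : ∀ i, EV (dd i),
          Real.exp (-(∑ i, (U i (z i) + ‖z i - mvec (A i) θ‖ ^ 2 / (2 * ρ ^ 2))))) /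
        (∫ θ' : EV d, ∫ z : ∀ i, EV (dd i),
          Real.exp (-(∑ i, (U i (z i) + ‖z i - mvec (A i) θ'‖ ^ 2 / (2 * ρ ^ 2)))))|

/-- The (unnormalised) parabolic cylinder integral. -/
def Ipc (n : ℕ) (t : ℝ) : ℝ :=
  ∫ x in Set.Ioi (0 : ℝ), Real.exp (-x * t - x ^ 2 / 2) * x ^ ((n : ℝ) - 1)

lemma ipc_int (t : ℝ) {r : ℝ} (hr : -1 < r) :
    IntegrableOn (fun x : ℝ => Real.exp (-x * t - x ^ 2 / 2) * x ^ r) (Set.Ioi 0) := by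
  have h := (integrableOn_rpow_mul_exp_neg_mul_sq (b := 1 / 4) (by norm_num) hr).const_mul
    (Real.exp (t ^ 2))
  refine Integrable.mono' h ?_ ?_
  · exact (by fun_prop : Measurable fun x : ℝ =>
      Real.exp (-x * t - x ^ 2 / 2) * x ^ r).aestronglyMeasurable
  · refine (ae_restrict_iff' measurableSet_Ioi).2 (ae_of_all _ fun x hx => ?_)
    have hx' : (0 : ℝ) < x := hx
    have hp : 0 ≤ x ^ r := Real.rpow_nonneg hx'.le r
    rw [Real.norm_of_nonneg (by positivity)]
    have : Real.exp (-x * t - x ^ 2 / 2) ≤ Real.exp (t ^ 2) * Real.exp (-(1 / 4) * x ^ 2) := by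
      rw [← Real.exp_add]
      apply Real.exp_le_exp.2
      nlinarith [sq_nonneg (x / 2 + t)]
    calc _ ≤ Real.exp (t ^ 2) * Real.exp (-(1 / 4) * x ^ 2) * x ^ r := by gcongr
      _ = _ := by ring

lemma cast_gt {n : ℕ} (hn : 0 < n) : (-1 : ℝ) < (n : ℝ) - 1 := by
  have : (0 : ℝ) < n := by exact_mod_cast hn
  linarith

lemma ipc_pos {n : ℕ} (hn : 0 < n) (t : ℝ) : 0 < Ipc n t := by
  unfold Ipc
  rw [setIntegral_pos_iff_support_of_nonneg_ae]
  · have : Function.support (fun x : ℝ => Real.exp (-x * t - x ^ 2 / 2) * x ^ ((n : ℝ) - 1))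
        ∩ Set.Ioi 0 = Set.Ioi 0 := by
      apply Set.inter_eq_right.2
      intro x hx
      have hx' : (0 : ℝ) < x := hx
      have : 0 < x ^ ((n : ℝ) - 1) := Real.rpow_pos_of_pos hx' _
      simp only [Function.mem_support]
      positivity
    rw [this]
    simp
  · refine (ae_restrict_iff' measurableSet_Ioi).2 (ae_of_all _ fun x hx => ?_)
    have hx' : (0 : ℝ) < x := hx
    have : 0 < x ^ ((n : ℝ) - 1) := Real.rpow_pos_of_pos hx' _
    simp only [Pi.zero_apply]
    positivity
  · exact ipc_int t (cast_gt hn)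

lemma parCyl_ratio {n : ℕ} (hn : 0 < n) (t : ℝ) :
    parCyl n t / parCyl n (-t) = Ipc n t / Ipc n (-t) := by
  have h1 : Real.Gamma (n : ℝ) ≠ 0 := (Real.Gamma_pos_of_pos (by exact_mod_cast hn)).ne'
  have e1 : ∀ z, parCyl n z = Real.exp (-z ^ 2 / 4) * (Real.Gamma n)⁻¹ * Ipc n z := fun z => rfl
  rw [e1, e1, neg_sq]
  apply mul_div_mul_left
  exact mul_ne_zero (Real.exp_pos _).ne' (inv_ne_zero h1)

lemma radial_eq {n : ℕ} (hn : 0 < n) (L : ℝ) {ρ : ℝ} (hρ : 0 < ρ) {x : ℝ} (hx : 0 < x) :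
    (ρ * x) ^ (n - 1) • Real.exp (-(L * (ρ * x)) - (ρ * x) ^ 2 / (2 * ρ ^ 2))
      = ρ ^ (n - 1) * (Real.exp (-x * (L * ρ) - x ^ 2 / 2) * x ^ ((n : ℝ) - 1)) := by
  have h : x ^ ((n : ℝ) - 1) = x ^ (n - 1) := by
    rw [← Real.rpow_natCast, Nat.cast_sub hn, Nat.cast_one]
  rw [h, mul_pow, smul_eq_mul]
  have : -(L * (ρ * x)) - (ρ * x) ^ 2 / (2 * ρ ^ 2) = -x * (L * ρ) - x ^ 2 / 2 := by
    field_simp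
  rw [this]; ring

lemma gauss_integrable {n : ℕ} (hn : 0 < n) (L : ℝ) {ρ : ℝ} (hρ : 0 < ρ) :
    Integrable fun u : EV n => Real.exp (-(L * ‖u‖) - ‖u‖ ^ 2 / (2 * ρ ^ 2)) := by
  have : Nonempty (Fin n) := ⟨⟨0, hn⟩⟩
  have := (integrable_fun_norm_addHaar (volume : Measure (EV n))
    (f := fun y : ℝ => Real.exp (-(L * y) - y ^ 2 / (2 * ρ ^ 2)))).2
  apply this
  rw [finrank_euclideanSpace_fin]
  have h := integrableOn_Ioi_comp_mul_left_iff
    (fun y : ℝ => y ^ (n - 1) • Real.exp (-(L * y) - y ^ 2 / (2 * ρ ^ 2))) 0 hρ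
  rw [mul_zero] at h
  rw [← h]
  refine (integrableOn_congr_fun ?_ measurableSet_Ioi).2
    ((ipc_int (L * ρ) (cast_gt hn)).const_mul (ρ ^ (n - 1)))
  intro x hx
  exact radial_eq hn L hρ hx

lemma gauss_eq {n : ℕ} (hn : 0 < n) {ρ : ℝ} (hρ : 0 < ρ) :
    ∃ C : ℝ, 0 < C ∧ ∀ L : ℝ,
    ∫ u : EV n, Real.exp (-(L * ‖u‖) - ‖u‖ ^ 2 / (2 * ρ ^ 2)) = C * Ipc n (L * ρ) := by
  have : Nonempty (Fin n) := ⟨⟨0, hn⟩⟩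
  refine ⟨n * (volume : Measure (EV n)).real (Metric.ball 0 1) * (ρ * ρ ^ (n - 1)), ?_, ?_⟩
  · have : 0 < (volume : Measure (EV n)).real (Metric.ball 0 1) :=
      ENNReal.toReal_pos (Metric.measure_ball_pos _ _ one_pos).ne' measure_ball_lt_top.ne
    have : (0 : ℝ) < n := by exact_mod_cast hn
    positivity
  intro L
  rw [integral_fun_norm_addHaar (volume : Measure (EV n))
    (fun y : ℝ => Real.exp (-(L * y) - y ^ 2 / (2 * ρ ^ 2))), finrank_euclideanSpace_fin]
  have h := integral_comp_mul_left_Ioi'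
    (fun y : ℝ => y ^ (n - 1) • Real.exp (-(L * y) - y ^ 2 / (2 * ρ ^ 2))) 0 hρ
  rw [mul_zero] at h
  rw [← h, setIntegral_congr_fun measurableSet_Ioi
    (fun x hx => radial_eq hn L hρ hx), integral_const_mul]
  simp only [nsmul_eq_mul, smul_eq_mul]
  unfold Ipc
  ring

lemma moment_le {n : ℕ} (hn : 0 < n) : Ipc (n + 1) 0 ≤ Real.sqrt n * Ipc n 0 := by
  have hn' : (0 : ℝ) < n := by exact_mod_cast hn
  have hg := cast_gt hn
  have key : ∀ r : ℝ, -1 < r → ∫ x in Set.Ioi (0 : ℝ), Real.exp (-x * 0 - x ^ 2 / 2) * x ^ r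
      = (1 / 2 : ℝ) ^ (-(r + 1) / 2) * (1 / 2) * Real.Gamma ((r + 1) / 2) := by
    intro r hr
    rw [← integral_rpow_mul_exp_neg_mul_rpow two_pos hr (by norm_num)]
    refine setIntegral_congr_fun measurableSet_Ioi fun x _ => ?_
    simp only [Real.rpow_two]
    rw [mul_comm]; congr 2; ring
  have h2 : Ipc (n + 2) 0 = n * Ipc n 0 := by
    unfold Ipc
    rw [key _ (cast_gt (by omega)), key _ hg]
    push_cast
    have e1 : ((n : ℝ) + 2 - 1 + 1) / 2 = n / 2 + 1 := by ring
    have e2 : ((n : ℝ) - 1 + 1) / 2 = n / 2 := by ring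
    have e3 : -((n : ℝ) + 2 - 1 + 1) / 2 = -((n : ℝ) - 1 + 1) / 2 + (-1) := by ring
    rw [e1, e2, e3, Real.Gamma_add_one (by positivity), Real.rpow_add (by norm_num),
      Real.rpow_neg_one]
    ring
  set s := Real.sqrt n with hs
  have hss : s * s = n := Real.mul_self_sqrt hn'.le
  have hs0 : 0 < s := Real.sqrt_pos.2 hn'
  have i0 := ipc_int 0 hg
  have i1 := ipc_int 0 (cast_gt (n := n + 1) (by omega))
  have i2 := ipc_int 0 (cast_gt (n := n + 2) (by omega))
  have h3 : 0 ≤ Ipc (n + 2) 0 - 2 * s * Ipc (n + 1) 0 + s * s * Ipc n 0 := by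
    unfold Ipc
    rw [← integral_const_mul, ← integral_const_mul, ← integral_sub i2 (i1.const_mul _)]
    have hadd := integral_add (i2.sub (i1.const_mul (2 * s))) (i0.const_mul (s * s))
    simp only [Pi.sub_apply] at hadd
    rw [← hadd]
    refine setIntegral_nonneg measurableSet_Ioi fun x hx => ?_
    have hx' : (0 : ℝ) < x := hx
    have a1 : x ^ (((n + 1 : ℕ) : ℝ) - 1) = x ^ ((n : ℝ) - 1) * x := by
      rw [← Real.rpow_add_one hx'.ne']; congr 1; push_cast; ring
    have a2 : x ^ (((n + 2 : ℕ) : ℝ) - 1) = x ^ ((n : ℝ) - 1) * x * x := by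
      rw [← Real.rpow_add_one hx'.ne', ← Real.rpow_add_one hx'.ne']; congr 1; push_cast; ring
    rw [a1, a2]
    have hp : 0 < x ^ ((n : ℝ) - 1) := Real.rpow_pos_of_pos hx' _
    have : 0 ≤ Real.exp (-x * 0 - x ^ 2 / 2) * x ^ ((n : ℝ) - 1) * (x - s) ^ 2 := by positivity
    nlinarith
  rw [h2, ← hss] at h3
  have : 0 ≤ 2 * s * (s * Ipc n 0 - Ipc (n + 1) 0) := by nlinarith
  have := nonneg_of_mul_nonneg_right this (by positivity)
  linarith

lemma ipc_deriv {n : ℕ} (hn : 0 < n) : HasDerivAt (Ipc n) (-Ipc (n + 1) 0) 0 := by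
  have hg := cast_gt hn
  have := (hasDerivAt_integral_of_dominated_loc_of_deriv_le
    (μ := volume.restrict (Set.Ioi (0 : ℝ)))
    (F := fun t x : ℝ => Real.exp (-x * t - x ^ 2 / 2) * x ^ ((n : ℝ) - 1))
    (F' := fun t x : ℝ => -(Real.exp (-x * t - x ^ 2 / 2) * x ^ (((n + 1 : ℕ) : ℝ) - 1)))
    (x₀ := 0) (s := Metric.ball 0 1)
    (bound := fun x => Real.exp (-x * (-1) - x ^ 2 / 2) * x ^ (((n + 1 : ℕ) : ℝ) - 1))
    (Metric.ball_mem_nhds _ one_pos)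
    (Filter.Eventually.of_forall fun t => (ipc_int t hg).aestronglyMeasurable)
    (ipc_int 0 hg)
    (ipc_int 0 (cast_gt (n := n + 1) (by omega))).neg.aestronglyMeasurable ?_
    (ipc_int (-1) (cast_gt (n := n + 1) (by omega))) ?_).2
  · rw [integral_neg] at this
    exact this
  · refine (ae_restrict_iff' measurableSet_Ioi).2 (ae_of_all _ fun x hx t ht => ?_)
    have hx' : (0 : ℝ) < x := hx
    have : 0 < x ^ (((n + 1 : ℕ) : ℝ) - 1) := Real.rpow_pos_of_pos hx' _
    rw [norm_neg, Real.norm_of_nonneg (by positivity)]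
    rw [mem_ball_zero_iff, Real.norm_eq_abs, abs_lt] at ht
    gcongr ?_ * _
    apply Real.exp_le_exp.2
    nlinarith
  · refine (ae_restrict_iff' measurableSet_Ioi).2 (ae_of_all _ fun x hx t _ => ?_)
    have hx' : (0 : ℝ) < x := hx
    have a1 : x ^ (((n + 1 : ℕ) : ℝ) - 1) = x ^ ((n : ℝ) - 1) * x := by
      rw [← Real.rpow_add_one hx'.ne']; congr 1; push_cast; ring
    rw [a1]
    have h1 : HasDerivAt (fun t : ℝ => -x * t - x ^ 2 / 2) (-x) t := by
      simpa using ((hasDerivAt_id t).const_mul (-x)).sub_const (x ^ 2 / 2)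
    have h2 := (h1.exp).mul_const (x ^ ((n : ℝ) - 1))
    refine h2.congr_deriv ?_
    ring

lemma ratio_deriv {n : ℕ} (hn : 0 < n) (L : ℝ) :
    HasDerivAt (fun ρ => Ipc n (L * ρ) / Ipc n (-(L * ρ)))
      (-(2 * L * (Ipc (n + 1) 0 / Ipc n 0))) 0 := by
  have hp := (ipc_pos hn 0).ne'
  have h := ipc_deriv hn
  have l1 : HasDerivAt (fun ρ : ℝ => L * ρ) L 0 := by
    simpa using (hasDerivAt_id (0 : ℝ)).const_mul L
  have h1 : HasDerivAt (fun ρ => Ipc n (L * ρ)) (-Ipc (n + 1) 0 * L) 0 :=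
    HasDerivAt.comp (0 : ℝ) (h₂ := Ipc n) (by simpa using h) l1
  have h2 : HasDerivAt (fun ρ => Ipc n (-(L * ρ))) (-Ipc (n + 1) 0 * (-L)) 0 :=
    HasDerivAt.comp (0 : ℝ) (h₂ := Ipc n) (h := fun ρ => -(L * ρ)) (by simpa using h) l1.neg
  have h3 := h1.div h2 (by simpa using hp)
  refine h3.congr_deriv ?_
  simp only [mul_zero, neg_zero]
  field_simp
  ring

lemma tv_abstract {α : Type*} [MeasurableSpace α] {μ : Measure α} {f F : α → ℝ} {m M : ℝ}
    (hm : 0 < m) (hM : 0 < M) (hf : Integrable f μ) (hF : AEStronglyMeasurable F μ)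
    (hf0 : ∀ x, 0 ≤ f x) (hpos : 0 < ∫ x, f x ∂μ)
    (h1 : ∀ x, m * f x ≤ F x) (h2 : ∀ x, F x ≤ M * f x) :
    (1 / 2) * ∫ x, |f x / (∫ y, f y ∂μ) - F x / (∫ y, F y ∂μ)| ∂μ ≤ 1 - m / M := by
  have hF0 : ∀ x, 0 ≤ F x := fun x => (mul_nonneg hm.le (hf0 x)).trans (h1 x)
  have hFi : Integrable F μ := (hf.const_mul M).mono' hF
    (ae_of_all _ fun x => by rw [Real.norm_of_nonneg (hF0 x)]; exact h2 x)
  have e1 : m * ∫ x, f x ∂μ ≤ ∫ x, F x ∂μ := by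
    rw [← integral_const_mul]; exact integral_mono (hf.const_mul m) hFi h1
  have e2 : ∫ x, F x ∂μ ≤ M * ∫ x, f x ∂μ := by
    rw [← integral_const_mul]; exact integral_mono hFi (hf.const_mul M) h2
  set Z := ∫ x, f x ∂μ
  set W := ∫ x, F x ∂μ
  have hW : 0 < W := (mul_pos hm hpos).trans_le e1
  have hmM : m ≤ M := le_of_mul_le_mul_right (e1.trans e2) hpos
  have hc1 : m / M ≤ 1 := (div_le_one hM).2 hmM
  have hpt : ∀ x, |f x / Z - F x / W| ≤ (1 - 2 * (m / M)) * (f x / Z) + F x / W := by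
    intro x
    have hp : 0 ≤ f x / Z := div_nonneg (hf0 x) hpos.le
    have hq : m / M * (f x / Z) ≤ F x / W := by
      rw [div_mul_div_comm]
      exact div_le_div₀ (hF0 x) (h1 x) hW e2
    have h3 : m / M * (f x / Z) ≤ f x / Z := mul_le_of_le_one_left hp hc1
    rw [abs_le]
    constructor <;> nlinarith
  have hint : Integrable (fun x => (1 - 2 * (m / M)) * (f x / Z) + F x / W) μ :=
    ((hf.div_const Z).const_mul _).add (hFi.div_const W)
  have hab : Integrable (fun x => |f x / Z - F x / W|) μ :=
    ((hf.div_const Z).sub (hFi.div_const W)).abs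
  have h4 := integral_mono hab hint hpt
  rw [integral_add ((hf.div_const Z).const_mul _) (hFi.div_const W), integral_const_mul,
    integral_div, integral_div, div_self hpos.ne', div_self hW.ne'] at h4
  linarith

lemma mvec_cont {m n : ℕ} (A : Matrix (Fin m) (Fin n) ℝ) : Continuous (mvec A) := by
  unfold mvec
  exact (EuclideanSpace.equiv (Fin m) ℝ).symm.continuous.comp
    ((Continuous.matrix_mulVec continuous_const
      (EuclideanSpace.equiv (Fin n) ℝ).continuous))

lemma mvec_integrable {m d : ℕ} (h : m = d) (A : Matrix (Fin m) (Fin d) ℝ)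
    (hA : IsUnit (Matrix.det (Matrix.reindex (finCongr h) (Equiv.refl (Fin d)) A)))
    {g : EV m → ℝ} (hg : Integrable g) : Integrable fun θ : EV d => g (mvec A θ) := by
  subst h
  have hA' : A.det ≠ 0 := by simpa using hA
  have e : (mvec A : EV m → EV m) = (Matrix.toLin (PiLp.basisFun 2 ℝ (Fin m))
      (PiLp.basisFun 2 ℝ (Fin m)) A) := by
    rw [← Matrix.toLpLin_eq_toLin]
    ext x i
    simp [mvec]
    rfl
  have hdet : LinearMap.det (Matrix.toLin (PiLp.basisFun 2 ℝ (Fin m))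
      (PiLp.basisFun 2 ℝ (Fin m)) A) ≠ 0 := by
    rw [LinearMap.det_toLin]; exact hA'
  have hmap := Measure.map_linearMap_addHaar_eq_smul_addHaar (volume : Measure (EV m)) hdet
  rw [← e] at hmap
  have : Integrable g (Measure.map (mvec A) volume) := by
    rw [hmap]; exact hg.smul_measure ENNReal.ofReal_ne_top
  exact this.comp_measurable (mvec_cont A).measurable

lemma lip_cont {n : ℕ} {U : EV n → ℝ} {L : ℝ}
    (hU : ∀ z z' : EV n, |U z' - U z| ≤ L * ‖z' - z‖) : Continuous U := by
  refine (LipschitzWith.of_dist_le_mul (K := L.toNNReal) fun x y => ?_).continuous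
  rw [Real.dist_eq, dist_eq_norm]
  exact (hU y x).trans (mul_le_mul_of_nonneg_right (Real.le_coe_toNNReal L) (norm_nonneg _))

lemma G_meas {n : ℕ} {U : EV n → ℝ} (hU : Continuous U) (ρ : ℝ) :
    StronglyMeasurable fun a : EV n =>
      ∫ z : EV n, Real.exp (-(U z + ‖z - a‖ ^ 2 / (2 * ρ ^ 2))) := by
  apply StronglyMeasurable.integral_prod_right'
    (f := fun p : EV n × EV n => Real.exp (-(U p.2 + ‖p.2 - p.1‖ ^ 2 / (2 * ρ ^ 2))))
  apply Continuous.stronglyMeasurable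
  fun_prop

lemma G_bounds {n : ℕ} (hn : 0 < n) {U : EV n → ℝ} {L : ℝ}
    (hU : ∀ z z' : EV n, |U z' - U z| ≤ L * ‖z' - z‖) {ρ : ℝ} (hρ : 0 < ρ) (a : EV n) :
    (∫ u : EV n, Real.exp (-(L * ‖u‖) - ‖u‖ ^ 2 / (2 * ρ ^ 2))) * Real.exp (-U a)
        ≤ ∫ z : EV n, Real.exp (-(U z + ‖z - a‖ ^ 2 / (2 * ρ ^ 2))) ∧
      ∫ z : EV n, Real.exp (-(U z + ‖z - a‖ ^ 2 / (2 * ρ ^ 2))) ≤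
      (∫ u : EV n, Real.exp (-(-L * ‖u‖) - ‖u‖ ^ 2 / (2 * ρ ^ 2))) * Real.exp (-U a) := by
  have hc := lip_cont hU
  rw [← integral_add_right_eq_self
    (fun z : EV n => Real.exp (-(U z + ‖z - a‖ ^ 2 / (2 * ρ ^ 2)))) a]
  simp only [add_sub_cancel_right]
  have hle : ∀ u : EV n, Real.exp (-(U (u + a) + ‖u‖ ^ 2 / (2 * ρ ^ 2))) ≤
      Real.exp (-(-L * ‖u‖) - ‖u‖ ^ 2 / (2 * ρ ^ 2)) * Real.exp (-U a) := by
    intro u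
    have := abs_le.1 (hU a (u + a))
    rw [add_sub_cancel_right] at this
    rw [← Real.exp_add]
    apply Real.exp_le_exp.2
    linarith [this.1]
  have hge : ∀ u : EV n, Real.exp (-(L * ‖u‖) - ‖u‖ ^ 2 / (2 * ρ ^ 2)) * Real.exp (-U a) ≤
      Real.exp (-(U (u + a) + ‖u‖ ^ 2 / (2 * ρ ^ 2))) := by
    intro u
    have := abs_le.1 (hU a (u + a))
    rw [add_sub_cancel_right] at this
    rw [← Real.exp_add]
    apply Real.exp_le_exp.2
    linarith [this.2]
  have i1 := (gauss_integrable hn L hρ).mul_const (Real.exp (-U a))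
  have i2 := (gauss_integrable hn (-L) hρ).mul_const (Real.exp (-U a))
  have i3 : Integrable fun u : EV n => Real.exp (-(U (u + a) + ‖u‖ ^ 2 / (2 * ρ ^ 2))) := by
    refine i2.mono' (Continuous.aestronglyMeasurable (by fun_prop)) (ae_of_all _ fun u => ?_)
    rw [Real.norm_of_nonneg (Real.exp_pos _).le]
    exact hle u
  rw [← integral_mul_const, ← integral_mul_const]
  exact ⟨integral_mono i1 i3 hge, integral_mono i3 i2 hle⟩

lemma target_integrable {d b : ℕ} (dd : Fin b → ℕ)
    (A : ∀ i, Matrix (Fin (dd i)) (Fin d) ℝ) (U : ∀ i, EV (dd i) → ℝ)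
    (hcont : ∀ i, Continuous (U i))
    (hA0bdd : ∀ j, BddBelow (Set.range (U j)))
    (hA0 : ∃ i, ∃ h : dd i = d,
      IsUnit (Matrix.det (Matrix.reindex (finCongr h) (Equiv.refl (Fin d)) (A i))) ∧
      Integrable fun z : EV (dd i) => Real.exp (-U i z)) :
    Integrable fun θ : EV d => Real.exp (-(∑ i, U i (mvec (A i) θ))) := by
  obtain ⟨i, h, hdet, hint⟩ := hA0
  choose c hc using hA0bdd
  have h1 := (mvec_integrable h (A i) hdet hint).mul_const
    (Real.exp (-(∑ j ∈ Finset.univ.erase i, c j)))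
  refine h1.mono' (Continuous.aestronglyMeasurable ?_) (ae_of_all _ fun θ => ?_)
  · refine Real.continuous_exp.comp (Continuous.neg (continuous_finsetSum _ fun j _ => ?_))
    exact (hcont j).comp (mvec_cont (A j))
  · rw [Real.norm_of_nonneg (Real.exp_pos _).le, ← Real.exp_add]
    apply Real.exp_le_exp.2
    rw [← Finset.add_sum_erase _ _ (Finset.mem_univ i)]
    have : ∑ j ∈ Finset.univ.erase i, c j ≤ ∑ j ∈ Finset.univ.erase i, U j (mvec (A j) θ) :=
      Finset.sum_le_sum fun j _ => hc j ⟨_, rfl⟩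
    linarith

lemma tv_bound {d b : ℕ}
    (dd : Fin b → ℕ) (hdd : ∀ i, 0 < dd i)
    (A : ∀ i, Matrix (Fin (dd i)) (Fin d) ℝ) (U : ∀ i, EV (dd i) → ℝ)
    (L : Fin b → ℝ)
    (hA0bdd : ∀ j, BddBelow (Set.range (U j)))
    (hA0 : ∃ i, ∃ h : dd i = d,
      IsUnit (Matrix.det (Matrix.reindex (finCongr h) (Equiv.refl (Fin d)) (A i))) ∧
      Integrable fun z : EV (dd i) => Real.exp (-U i z))
    (hA1 : ∀ i (z z' : EV (dd i)), |U i z' - U i z| ≤ L i * ‖z' - z‖)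
    (ρ : ℝ) (hρ : 0 < ρ) :
    tvBias dd A U ρ ≤ 1 - ∏ i, Ipc (dd i) (L i * ρ) / Ipc (dd i) (-(L i * ρ)) := by
  have hcont : ∀ i, Continuous (U i) := fun i => lip_cont (hA1 i)
  have hint := target_integrable dd A U hcont hA0bdd hA0
  have hprod : ∀ θ : EV d, (∫ z : ∀ i, EV (dd i),
      Real.exp (-(∑ i, (U i (z i) + ‖z i - mvec (A i) θ‖ ^ 2 / (2 * ρ ^ 2))))) =
      ∏ i, ∫ z : EV (dd i), Real.exp (-(U i z + ‖z - mvec (A i) θ‖ ^ 2 / (2 * ρ ^ 2))) := by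
    intro θ
    rw [← integral_fintype_prod_volume_eq_prod (fun i (z : EV (dd i)) =>
      Real.exp (-(U i z + ‖z - mvec (A i) θ‖ ^ 2 / (2 * ρ ^ 2))))]
    simp only [← Real.exp_sum, Finset.sum_neg_distrib]
  choose C hC0 hC using fun i => gauss_eq (hdd i) hρ
  have hI : ∀ i t, 0 < Ipc (dd i) t := fun i t => ipc_pos (hdd i) t
  have hb := fun i θ => G_bounds (hdd i) (hA1 i) hρ (mvec (A i) θ)
  simp only [hC] at hb
  unfold tvBias
  simp only [hprod]
  have hfin : ∏ i, Ipc (dd i) (L i * ρ) / Ipc (dd i) (-(L i * ρ)) =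
      (∏ i, C i * Ipc (dd i) (L i * ρ)) / ∏ i, C i * Ipc (dd i) (-L i * ρ) := by
    rw [← Finset.prod_div_distrib]
    refine Finset.prod_congr rfl fun i _ => ?_
    rw [mul_div_mul_left _ _ (hC0 i).ne', neg_mul]
  rw [hfin]
  refine tv_abstract (Finset.prod_pos fun i _ => mul_pos (hC0 i) (hI i _))
    (Finset.prod_pos fun i _ => mul_pos (hC0 i) (hI i _)) hint ?_
    (fun θ => (Real.exp_pos _).le) ?_ ?_ ?_
  · refine (Finset.stronglyMeasurable_fun_prod _ fun i _ => ?_).aestronglyMeasurable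
    exact (G_meas (hcont i) ρ).comp_measurable (mvec_cont (A i)).measurable
  · exact integral_exp_pos hint
  · intro θ
    rw [← Finset.sum_neg_distrib, Real.exp_sum, ← Finset.prod_mul_distrib]
    exact Finset.prod_le_prod (fun i _ => (mul_pos (mul_pos (hC0 i) (hI i _))
      (Real.exp_pos _)).le) fun i _ => (hb i θ).1
  · intro θ
    rw [← Finset.sum_neg_distrib, Real.exp_sum, ← Finset.prod_mul_distrib]
    exact Finset.prod_le_prod (fun i _ => integral_nonneg fun _ => (Real.exp_pos _).le)
      fun i _ => (hb i θ).2

theorem stmt9 {d b : ℕ} (hd : 0 < d) (hb : 0 < b)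
    (dd : Fin b → ℕ) (hdd : ∀ i, 0 < dd i)
    (A : ∀ i, Matrix (Fin (dd i)) (Fin d) ℝ) (U : ∀ i, EV (dd i) → ℝ)
    (L : Fin b → ℝ)
    -- (A0)
    (hA0bdd : ∀ j, BddBelow (Set.range (U j)))
    (hA0 : ∃ i, ∃ h : dd i = d,
      IsUnit (Matrix.det (Matrix.reindex (finCongr h) (Equiv.refl (Fin d)) (A i))) ∧
      Integrable fun z : EV (dd i) => Real.exp (-U i z))
    -- (A1): each Uᵢ is Lᵢ-Lipschitz
    (hA1 : ∀ i (z z' : EV (dd i)), |U i z' - U i z| ≤ L i * ‖z' - z‖) :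
    -- non-asymptotic bound, for every ρ > 0
    (∀ ρ : ℝ, 0 < ρ →
      tvBias dd A U ρ ≤ 1 - ∏ i, parCyl (dd i) (L i * ρ) / parCyl (dd i) (-(L i * ρ))) ∧
    -- asymptotic bound as ρ → 0⁺:  TV ≤ 2ρ Σᵢ √dᵢ Lᵢ + o(ρ)
    (∃ g : ℝ → ℝ, g =o[𝓝[>] (0 : ℝ)] (fun ρ => ρ) ∧
      ∀ ρ : ℝ, 0 < ρ →
        tvBias dd A U ρ ≤ 2 * ρ * (∑ i, Real.sqrt (dd i) * L i) + g ρ) := by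
  have hL : ∀ i, 0 ≤ L i := by
    intro i
    have : Nonempty (Fin (dd i)) := ⟨⟨0, hdd i⟩⟩
    obtain ⟨x, hx⟩ := exists_ne (0 : EV (dd i))
    have h := (abs_nonneg _).trans (hA1 i 0 x)
    rw [sub_zero] at h
    exact nonneg_of_mul_nonneg_left h (norm_pos_iff.2 hx)
  have main := tv_bound dd hdd A U L hA0bdd hA0 hA1
  refine ⟨fun ρ hρ => ?_, ?_⟩
  · have e : ∏ i, parCyl (dd i) (L i * ρ) / parCyl (dd i) (-(L i * ρ)) =
        ∏ i, Ipc (dd i) (L i * ρ) / Ipc (dd i) (-(L i * ρ)) :=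
      Finset.prod_congr rfl fun i _ => parCyl_ratio (hdd i) _
    rw [e]
    exact main ρ hρ
  · have hder := HasDerivAt.fun_finsetProd (u := Finset.univ)
      (fun i _ => ratio_deriv (hdd i) (L i))
    have hone : ∀ i, Ipc (dd i) 0 / Ipc (dd i) 0 = 1 := fun i => div_self (ipc_pos (hdd i) 0).ne'
    have ho := (hasDerivAt_iff_isLittleO.1 hder).neg_left
    simp only [mul_zero, neg_zero, hone, Finset.prod_const_one, sub_zero, one_mul,
      smul_eq_mul] at ho
    refine ⟨_, ho.mono nhdsWithin_le_nhds, fun ρ hρ => (main ρ hρ).trans ?_⟩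
    have hs : ∑ i, L i * (Ipc (dd i + 1) 0 / Ipc (dd i) 0) ≤ ∑ i, Real.sqrt (dd i) * L i := by
      refine Finset.sum_le_sum fun i _ => ?_
      rw [mul_comm]
      refine mul_le_mul_of_nonneg_right ?_ (hL i)
      rw [div_le_iff₀ (ipc_pos (hdd i) 0)]
      exact moment_le (hdd i)
    have hs2 : ∑ i, -(2 * L i * (Ipc (dd i + 1) 0 / Ipc (dd i) 0)) =
        -(2 * ∑ i, L i * (Ipc (dd i + 1) 0 / Ipc (dd i) 0)) := by
      rw [Finset.sum_neg_distrib, Finset.mul_sum]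
      simp only [mul_assoc]
    rw [hs2]
    have := mul_le_mul_of_nonneg_left hs hρ.le
    linarith

end
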